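/- Let N be a nonassociative algebra over a field K and let F be a subalgebra of N such that N = F + N², where N² is the linear span of all products of two elements of N. Then N^i ⊆ F^i + N^{i+1} for every i ≥ 1, where the powers of an algebra (or subalgebra) S are defined by S¹ = S and Sⁱ = Σ_{r+s=i} SʳSˢ. Consequently, N = F + N^m for every m ≥ 1. -/

import Mathlib

/-- The product of two subspaces of a (possibly non-associative, non-unital, non-commutative)
algebra: the linear span of all products `x * y` with `x ∈ M`, `y ∈ N`. -/
def subMul {K A : Type*} [Field K] [NonUnitalNonAssocRing A] [Module K A]
    [SMulCommClass K A A] [IsScalarTower K A A]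
    (M N : Submodule K A) : Submodule K A :=
  Submodule.map₂ (LinearMap.mul K A) M N

/-- The powers `Sⁱ` of a subspace `S`, defined (for `i ≥ 1`) by `S¹ = S` and
`Sⁱ = Σ_{r+s=i, r,s ≥ 1} Sʳ Sˢ`.  (We set `S⁰ = S`, an irrelevant junk value.) -/
def algPow {K A : Type*} [Field K] [NonUnitalNonAssocRing A] [Module K A]
    [SMulCommClass K A A] [IsScalarTower K A A]
    (S : Submodule K A) : ℕ → Submodule K A
  | 0 => S
  | 1 => S
  | n + 2 => ⨆ r : Fin (n + 1), subMul (algPow S (r + 1)) (algPow S (n + 1 - r))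
  decreasing_by
  · omega
  · omega

section

variable {K A : Type*} [Field K] [NonUnitalNonAssocRing A] [Module K A]
  [SMulCommClass K A A] [IsScalarTower K A A]

theorem subMul_mono {M M' P P' : Submodule K A} (h : M ≤ M') (h' : P ≤ P') :
    subMul M P ≤ subMul M' P' :=
  Submodule.map₂_le_map₂ h h'

theorem algPow_one (S : Submodule K A) : algPow S 1 = S := by
  rw [algPow]

theorem algPow_add_two (S : Submodule K A) (n : ℕ) :
    algPow S (n + 2) =
      ⨆ r : Fin (n + 1), subMul (algPow S (r + 1)) (algPow S (n + 1 - r)) := by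
  rw [algPow]

theorem subMul_algPow_le (S : Submodule K A) {r s : ℕ} (hr : 1 ≤ r) (hs : 1 ≤ s) :
    subMul (algPow S r) (algPow S s) ≤ algPow S (r + s) := by
  obtain ⟨a, rfl⟩ := Nat.exists_eq_add_of_le' hr
  obtain ⟨b, rfl⟩ := Nat.exists_eq_add_of_le' hs
  rw [show a + 1 + (b + 1) = a + b + 2 by omega, algPow_add_two]
  refine le_iSup_of_le (⟨a, by omega⟩ : Fin (a + b + 1)) ?_
  rw [show a + b + 1 - a = b + 1 by omega]

/-- To bound a power of exponent at least two, it suffices to bound the products of smaller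
powers. -/
theorem algPow_le {S T : Submodule K A} {i : ℕ} (hi : 2 ≤ i)
    (h : ∀ r s, 1 ≤ r → 1 ≤ s → r + s = i → subMul (algPow S r) (algPow S s) ≤ T) :
    algPow S i ≤ T := by
  obtain ⟨n, rfl⟩ := Nat.exists_eq_add_of_le' hi
  rw [algPow_add_two]
  exact iSup_le fun r => h _ _ (by omega) (by omega) (by omega)

theorem algPow_mono {S T : Submodule K A} (h : S ≤ T) {i : ℕ} (hi : 1 ≤ i) :
    algPow S i ≤ algPow T i := by
  induction i using Nat.strong_induction_on with
  | _ i ih =>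
    obtain rfl | hi2 := hi.eq_or_lt
    · simpa only [algPow_one] using h
    · refine algPow_le hi2 fun r s hr hs hrs => ?_
      subst hrs
      exact (subMul_mono (ih r (by omega) hr) (ih s (by omega) hs)).trans
        (subMul_algPow_le T hr hs)

theorem algPow_toSubmodule_le (F : NonUnitalSubalgebra K A) {i : ℕ} (hi : 1 ≤ i) :
    algPow F.toSubmodule i ≤ F.toSubmodule := by
  induction i using Nat.strong_induction_on with
  | _ i ih =>
    obtain rfl | hi2 := hi.eq_or_lt
    · rw [algPow_one]
    · refine algPow_le hi2 fun r s hr hs hrs => ?_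
      refine (subMul_mono (ih r (by omega) hr) (ih s (by omega) hs)).trans ?_
      exact Submodule.map₂_le.2 fun x hx y hy => F.mul_mem hx hy

theorem algPow_le_algPow_sup_succ {S T : Submodule K A} (hST : S ≤ T)
    (h : T ≤ S ⊔ subMul T T) {i : ℕ} (hi : 1 ≤ i) :
    algPow T i ≤ algPow S i ⊔ algPow T (i + 1) := by
  induction i using Nat.strong_induction_on with
  | _ i ih =>
    obtain rfl | hi2 := hi.eq_or_lt
    · have hT := subMul_algPow_le T le_rfl le_rfl
      simp only [algPow_one] at hT ⊢
      exact h.trans (sup_le_sup_left hT _)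
    · refine algPow_le hi2 fun r s hr hs hrs => ?_
      subst hrs
      have left : subMul (algPow T (r + 1)) (algPow T s) ≤ algPow T (r + s + 1) := by
        have := subMul_algPow_le T (Nat.le_add_left 1 r) hs
        rwa [show r + 1 + s = r + s + 1 by omega] at this
      have right : subMul (algPow S r) (algPow T (s + 1)) ≤ algPow T (r + s + 1) :=
        (subMul_mono (algPow_mono hST hr) le_rfl).trans
          (subMul_algPow_le T hr (Nat.le_add_left 1 s))
      calc subMul (algPow T r) (algPow T s)
          ≤ subMul (algPow S r ⊔ algPow T (r + 1)) (algPow T s) :=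
            subMul_mono (ih r (by omega) hr) le_rfl
        _ = subMul (algPow S r) (algPow T s) ⊔ subMul (algPow T (r + 1)) (algPow T s) :=
            Submodule.map₂_sup_left _ _ _ _
        _ ≤ subMul (algPow S r) (algPow S s ⊔ algPow T (s + 1)) ⊔ algPow T (r + s + 1) :=
            sup_le_sup (subMul_mono le_rfl (ih s (by omega) hs)) left
        _ = subMul (algPow S r) (algPow S s) ⊔ subMul (algPow S r) (algPow T (s + 1)) ⊔
              algPow T (r + s + 1) :=
            congrArg (· ⊔ _) (Submodule.map₂_sup_right _ _ _ _)
        _ ≤ algPow S (r + s) ⊔ algPow T (r + s + 1) :=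
            sup_le (sup_le_sup (subMul_algPow_le S hr hs) right) le_sup_right

end

/-- Let `N` be a nonassociative algebra over a field `K` and `F` a subalgebra
with `N = F + N²`.  Then `Nⁱ ⊆ Fⁱ + Nⁱ⁺¹` for every `i ≥ 1`, and consequently
`N = F + Nᵐ` for every `m ≥ 1`. -/
theorem pow_le_pow_sup_succ_of_eq_sup_sq {K N : Type*} [Field K]
    [NonUnitalNonAssocRing N] [Module K N] [SMulCommClass K N N] [IsScalarTower K N N]
    (F : NonUnitalSubalgebra K N)
    -- `N = F + N²`
    (hNF : (⊤ : Submodule K N) = F.toSubmodule ⊔ subMul (⊤ : Submodule K N) ⊤) :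
    (∀ i, 1 ≤ i →
      algPow (⊤ : Submodule K N) i ≤ algPow F.toSubmodule i ⊔ algPow (⊤ : Submodule K N) (i + 1)) ∧
    (∀ m, 1 ≤ m → (⊤ : Submodule K N) = F.toSubmodule ⊔ algPow (⊤ : Submodule K N) m) := by
  have step : ∀ i, 1 ≤ i → algPow (⊤ : Submodule K N) i ≤
      algPow F.toSubmodule i ⊔ algPow (⊤ : Submodule K N) (i + 1) :=
    fun i hi => algPow_le_algPow_sup_succ le_top hNF.le hi
  refine ⟨step, fun m hm => ?_⟩
  induction m, hm using Nat.le_induction with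
  | base => rw [algPow_one, sup_top_eq]
  | succ m hm ih =>
    refine le_antisymm ?_ le_top
    calc (⊤ : Submodule K N) = F.toSubmodule ⊔ algPow ⊤ m := ih
      _ ≤ F.toSubmodule ⊔ algPow ⊤ (m + 1) :=
        sup_le le_sup_left
          ((step m hm).trans (sup_le_sup_right (algPow_toSubmodule_le F hm) _))
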